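/- Let δ, ε be k-derivations of A that are both m-integrable, i.e., each extends to a Hasse–Schmidt derivation of length m with first component δ (resp. ε). Then the Lie bracket [δ, ε] = δ∘ε − ε∘δ is also m-integrable. In particular, IDer_k(A; m) is a Lie subalgebra of Der_k(A). -/

import Mathlib

/-- A Hasse–Schmidt derivation of length `m ∈ ℕ ∪ {∞}`. -/
def IsHSE {k A : Type*} [CommRing k] [CommRing A] [Algebra k A]
    (m : ℕ∞) (D : ℕ → Module.End k A) : Prop :=
  D 0 = 1 ∧ ∀ n : ℕ, 1 ≤ n → (n : ℕ∞) ≤ m → ∀ x y : A,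
    D n (x * y) = ∑ i ∈ Finset.range (n + 1), D i x * D (n - i) y

/-- A derivation `δ` is `m`-integrable if some Hasse–Schmidt derivation of length `m`
has first component `δ`. -/
def IsIntegrable {k A : Type*} [CommRing k] [CommRing A] [Algebra k A]
    (m : ℕ∞) (δ : Derivation k A A) : Prop :=
  ∃ D : ℕ → Module.End k A, IsHSE m D ∧ D 1 = δ.toLinearMap

open Finset hiding antidiagonal mem_antidiagonal
open Finset.HasAntidiagonal

instance : HasAntidiagonal (ℕ × ℕ) := antidiagonalOfLocallyFinite

/-- A family of endomorphisms indexed by an additive monoid satisfies the Leibniz rule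
at the index `n`. -/
def LeibnizAt {k A M : Type*} [CommRing k] [CommRing A] [Algebra k A] [AddMonoid M]
    [HasAntidiagonal M] (D : M → Module.End k A) (n : M) : Prop :=
  ∀ x y : A, D n (x * y) = ∑ p ∈ antidiagonal n, D p.1 x * D p.2 y

theorem sum_antidiagonal_exchange {M N : Type*} [AddCommMonoid M] [HasAntidiagonal M]
    [AddCommMonoid N] (f : M → M → M → M → N) (n : M) :
    ∑ p ∈ antidiagonal n, ∑ q ∈ antidiagonal p.1, ∑ r ∈ antidiagonal p.2,
        f q.1 q.2 r.1 r.2 =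
      ∑ p ∈ antidiagonal n, ∑ q ∈ antidiagonal p.1, ∑ r ∈ antidiagonal p.2,
        f q.1 r.1 q.2 r.2 := by
  simp only [← sum_product', sum_sigma']
  refine sum_nbij'
    (fun t => ⟨(t.2.1.1 + t.2.2.1, t.2.1.2 + t.2.2.2),
      ((t.2.1.1, t.2.2.1), (t.2.1.2, t.2.2.2))⟩)
    (fun t => ⟨(t.2.1.1 + t.2.2.1, t.2.1.2 + t.2.2.2),
      ((t.2.1.1, t.2.2.1), (t.2.1.2, t.2.2.2))⟩) ?_ ?_ ?_ ?_ ?_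
  · rintro ⟨⟨a, b⟩, ⟨⟨c, d⟩, ⟨e, g⟩⟩⟩ h
    simp only [mem_sigma, mem_product, mem_antidiagonal] at h ⊢
    obtain ⟨rfl, rfl, rfl⟩ := h
    exact ⟨add_add_add_comm _ _ _ _, trivial, trivial⟩
  · rintro ⟨⟨a, b⟩, ⟨⟨c, d⟩, ⟨e, g⟩⟩⟩ h
    simp only [mem_sigma, mem_product, mem_antidiagonal] at h ⊢
    obtain ⟨rfl, rfl, rfl⟩ := h
    exact ⟨add_add_add_comm _ _ _ _, trivial, trivial⟩
  · rintro ⟨⟨a, b⟩, ⟨⟨c, d⟩, ⟨e, g⟩⟩⟩ h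
    simp only [mem_sigma, mem_product, mem_antidiagonal] at h ⊢
    obtain ⟨rfl, rfl, rfl⟩ := h
    rfl
  · rintro ⟨⟨a, b⟩, ⟨⟨c, d⟩, ⟨e, g⟩⟩⟩ h
    simp only [mem_sigma, mem_product, mem_antidiagonal] at h ⊢
    obtain ⟨rfl, rfl, rfl⟩ := h
    rfl
  · rintro ⟨⟨a, b⟩, ⟨⟨c, d⟩, ⟨e, g⟩⟩⟩ h
    rfl

/-- Two formal power series in two variables with constant term `1`, supported on complementary
sets of exponents, whose product is a prescribed series. -/
theorem exists_factorization {R : Type*} [Ring R] (S : ℕ × ℕ → Prop) (G : ℕ × ℕ → R)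
    (hG : G 0 = 1) :
    ∃ Q P : ℕ × ℕ → R, Q 0 = 1 ∧ P 0 = 1 ∧ (∀ n, n ≠ 0 → S n → P n = 0) ∧
      (∀ n, n ≠ 0 → ¬ S n → Q n = 0) ∧
      ∀ n, G n = ∑ p ∈ antidiagonal n, Q p.1 * P p.2 := by
  classical
  let up (W : ℕ × ℕ → R) (n : ℕ × ℕ) : R := if n = 0 then 1 else if S n then W n else 0
  let lo (W : ℕ × ℕ → R) (n : ℕ × ℕ) : R := if n = 0 then 1 else if S n then 0 else W n
  obtain ⟨W, hW⟩ : ∃ W : ℕ × ℕ → R, ∀ n, W n =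
      G n - ∑ p ∈ antidiagonal n with p.1 ≠ 0 ∧ p.2 ≠ 0, up W p.1 * lo W p.2 := by
    let F (n : ℕ × ℕ) (rec : ∀ i : ℕ × ℕ, i < n → R) : R :=
      let W' : ℕ × ℕ → R := fun i => if h : i < n then rec i h else 0
      G n - ∑ p ∈ antidiagonal n with p.1 ≠ 0 ∧ p.2 ≠ 0, up W' p.1 * lo W' p.2
    refine ⟨wellFounded_lt.fix F, fun n => ?_⟩
    rw [wellFounded_lt.fix_eq F n]
    refine congrArg (G n - ·) (sum_congr rfl fun p hp => ?_)
    simp only [mem_filter, mem_antidiagonal] at hp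
    obtain ⟨h, h1, h2⟩ := hp
    have l1 : p.1 < n := by
      rw [← h]; exact lt_add_of_pos_right _ (pos_iff_ne_zero.mpr h2)
    have l2 : p.2 < n := by
      rw [← h]; exact lt_add_of_pos_left _ (pos_iff_ne_zero.mpr h1)
    simp only [up, lo, l1, l2, dif_pos]
  refine ⟨up W, lo W, by simp [up], by simp [lo], fun n hn h => by simp [lo, hn, h],
    fun n hn h => by simp [up, hn, h], fun n => ?_⟩
  rcases eq_or_ne n 0 with rfl | hn
  · simp [up, lo, hG]
  have hne : ((n, 0) : (ℕ × ℕ) × (ℕ × ℕ)) ≠ (0, n) := fun h => hn (congrArg Prod.fst h)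
  have hfilter : ((antidiagonal n).filter fun p => ¬ (p.1 ≠ 0 ∧ p.2 ≠ 0)) = {(n, 0), (0, n)} := by
    ext ⟨a, b⟩
    simp only [mem_filter, mem_antidiagonal, mem_insert, mem_singleton, Prod.mk.injEq]
    constructor
    · rintro ⟨rfl, h⟩
      by_cases ha : a = 0
      · right; simp [ha]
      · left
        have : b = 0 := by by_contra hb; exact h ⟨ha, hb⟩
        simp [this]
    · rintro (⟨rfl, rfl⟩ | ⟨rfl, rfl⟩) <;> simp
  rw [← sum_filter_add_sum_filter_not (antidiagonal n) (fun p => p.1 ≠ 0 ∧ p.2 ≠ 0), hfilter,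
    sum_pair hne]
  have hsum : up W n * lo W 0 + up W 0 * lo W n = W n := by
    by_cases h : S n <;> simp [up, lo, hn, h]
  rw [hsum, hW n]
  abel

section Leibniz

variable {k A : Type*} [CommRing k] [CommRing A] [Algebra k A]

theorem leibnizAt_zero {M : Type*} [AddCommMonoid M] [PartialOrder M] [CanonicallyOrderedAdd M]
    [HasAntidiagonal M] {D : M → Module.End k A} (h : D 0 = 1) : LeibnizAt D 0 := by
  intro x y
  simp [antidiagonal_zero, h]

/-- If a convolution satisfies the Leibniz rule at `n`, and so do the factors of all of its terms
but one, then the composition forming the remaining term satisfies the Leibniz rule. -/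
theorem eval_eval_of_others {M : Type*} [AddCommMonoid M] [HasAntidiagonal M] [DecidableEq M]
    {G Q P : M → Module.End k A} {n : M} (hG : LeibnizAt G n)
    (hconv : ∀ n, G n = ∑ p ∈ antidiagonal n, Q p.1 * P p.2)
    {a : M × M} (ha : a ∈ antidiagonal n)
    (hQ : ∀ p ∈ antidiagonal n, p ≠ a → LeibnizAt Q p.1)
    (hP : ∀ p ∈ antidiagonal n, p ≠ a → LeibnizAt P p.2) (x y : A) :
    Q a.1 (P a.2 (x * y)) = ∑ q ∈ antidiagonal a.1, ∑ r ∈ antidiagonal a.2,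
      Q q.1 (P r.1 x) * Q q.2 (P r.2 y) := by
  have key : ∑ p ∈ antidiagonal n, Q p.1 (P p.2 (x * y)) =
      ∑ p ∈ antidiagonal n, ∑ q ∈ antidiagonal p.1, ∑ r ∈ antidiagonal p.2,
        Q q.1 (P r.1 x) * Q q.2 (P r.2 y) := by
    rw [sum_antidiagonal_exchange (fun a b c d => Q a (P c x) * Q b (P d y)) n]
    have := hG x y
    rw [hconv n] at this
    simp only [LinearMap.sum_apply, Module.End.mul_apply] at this
    rw [this]
    refine sum_congr rfl fun p _ => ?_
    simp only [hconv p.1, hconv p.2, LinearMap.sum_apply, Module.End.mul_apply, sum_mul_sum]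
  rw [← add_sum_erase _ _ ha, ← add_sum_erase (antidiagonal n) (fun p =>
    ∑ q ∈ antidiagonal p.1, ∑ r ∈ antidiagonal p.2, Q q.1 (P r.1 x) * Q q.2 (P r.2 y)) ha] at key
  have hrest : ∑ p ∈ (antidiagonal n).erase a, Q p.1 (P p.2 (x * y)) =
      ∑ p ∈ (antidiagonal n).erase a, ∑ q ∈ antidiagonal p.1, ∑ r ∈ antidiagonal p.2,
        Q q.1 (P r.1 x) * Q q.2 (P r.2 y) := by
    refine sum_congr rfl fun p hp => ?_
    obtain ⟨h1, h2⟩ := mem_erase.mp hp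
    rw [hP p h2 h1 x y, map_sum, sum_comm]
    exact sum_congr rfl fun r _ => hQ p h2 h1 _ _
  rw [hrest] at key
  exact add_right_cancel key

/-- The Leibniz rule holds trivially at exponents outside of an additively closed support. -/
theorem leibnizAt_of_support {M : Type*} [AddCommMonoid M] [HasAntidiagonal M]
    {D : M → Module.End k A} {T : M → Prop} (hT : ∀ i j, T i → T j → T (i + j))
    (hD : ∀ n, ¬ T n → D n = 0) {n : M} (hn : ¬ T n) : LeibnizAt D n := by
  intro x y
  rw [hD n hn, LinearMap.zero_apply]
  refine (sum_eq_zero fun p hp => ?_).symm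
  by_cases h1 : T p.1
  · by_cases h2 : T p.2
    · exact (hn (mem_antidiagonal.mp hp ▸ hT _ _ h1 h2)).elim
    · simp [hD _ h2]
  · simp [hD _ h1]

/-- The factors of a Hasse–Schmidt derivation in two variables along two complementary additively
closed sets of exponents are Hasse–Schmidt derivations. -/
theorem leibnizAt_factors {S : ℕ × ℕ → Prop} {G Q P : ℕ × ℕ → Module.End k A}
    (hS : ∀ i j, S i → S j → S (i + j))
    (hS' : ∀ i j, (i = 0 ∨ ¬ S i) → (j = 0 ∨ ¬ S j) → (i + j = 0 ∨ ¬ S (i + j)))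
    (hS0 : S 0) (hQ0 : Q 0 = 1) (hP0 : P 0 = 1)
    (hP : ∀ n, n ≠ 0 → S n → P n = 0) (hQ : ∀ n, n ≠ 0 → ¬ S n → Q n = 0)
    (hconv : ∀ n, G n = ∑ p ∈ antidiagonal n, Q p.1 * P p.2) (n : ℕ × ℕ)
    (hG : ∀ i ≤ n, LeibnizAt G i) : LeibnizAt Q n ∧ LeibnizAt P n := by
  induction n using WellFoundedLT.induction with
  | ind n ih =>
  rcases eq_or_ne n 0 with rfl | hn
  · exact ⟨leibnizAt_zero hQ0, leibnizAt_zero hP0⟩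
  have ih' : ∀ i < n, LeibnizAt Q i ∧ LeibnizAt P i := fun i hi =>
    ih i hi fun j hj => hG j (hj.trans hi.le)
  have hlt1 : ∀ p ∈ antidiagonal n, p ≠ (n, 0) → p.1 < n := by
    rintro ⟨a, b⟩ hp h
    obtain rfl := mem_antidiagonal.mp hp
    refine lt_add_of_pos_right _ (pos_iff_ne_zero.mpr ?_)
    rintro rfl
    simp at h
  have hlt2 : ∀ p ∈ antidiagonal n, p ≠ (0, n) → p.2 < n := by
    rintro ⟨a, b⟩ hp h
    obtain rfl := mem_antidiagonal.mp hp
    refine lt_add_of_pos_left _ (pos_iff_ne_zero.mpr ?_)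
    rintro rfl
    simp at h
  by_cases h : S n
  · have hPn : LeibnizAt P n := by
      refine leibnizAt_of_support (T := fun i => i = 0 ∨ ¬ S i) hS' (fun i hi => ?_) ?_
      · push Not at hi
        exact hP i hi.1 hi.2
      · push Not
        exact ⟨hn, h⟩
    refine ⟨fun x y => ?_, hPn⟩
    have := eval_eval_of_others (hG n le_rfl) hconv (a := (n, 0)) (by simp)
      (fun p hp hpa => (ih' _ (hlt1 p hp hpa)).1)
      (fun p hp _ => by
        by_cases hp' : p = (0, n)
        · rw [hp']; exact hPn
        · exact (ih' _ (hlt2 p hp hp')).2) x y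
    simpa [hP0] using this
  · have hQn : LeibnizAt Q n :=
      leibnizAt_of_support hS (fun i hi => hQ i (fun h0 => hi (h0 ▸ hS0)) hi) h
    refine ⟨hQn, fun x y => ?_⟩
    have := eval_eval_of_others (hG n le_rfl) hconv (a := (0, n)) (by simp)
      (fun p hp _ => by
        by_cases hp' : p = (n, 0)
        · rw [hp']; exact hQn
        · exact (ih' _ (hlt1 p hp hp')).1)
      (fun p hp hpa => (ih' _ (hlt2 p hp hpa)).2) x y
    simpa [hQ0] using this

theorem IsHSE.leibnizAt {m : ℕ∞} {D : ℕ → Module.End k A} (h : IsHSE m D) {n : ℕ}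
    (hn : (n : ℕ∞) ≤ m) : LeibnizAt D n := by
  rcases Nat.eq_zero_or_pos n with rfl | hpos
  · exact leibnizAt_zero h.1
  · intro x y
    rw [h.2 n hpos hn x y, Nat.sum_antidiagonal_eq_sum_range_succ_mk]

theorem LeibnizAt.mul_prod {D E : ℕ → Module.End k A} {n : ℕ × ℕ}
    (hD : LeibnizAt D n.1) (hE : LeibnizAt E n.2) :
    LeibnizAt (fun p : ℕ × ℕ => D p.1 * E p.2) n := by
  intro x y
  simp only [Module.End.mul_apply]
  rw [hE x y, map_sum, sum_congr rfl fun r _ => hD _ _, sum_comm, ← sum_product']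
  refine sum_nbij' (fun t => ((t.1.1, t.2.1), (t.1.2, t.2.2)))
    (fun t => ((t.1.1, t.2.1), (t.1.2, t.2.2))) ?_ ?_ (fun _ _ => rfl) (fun _ _ => rfl)
    (fun _ _ => rfl)
  · rintro ⟨⟨a, b⟩, ⟨c, d⟩⟩ h
    simpa [Prod.ext_iff] using h
  · rintro ⟨⟨a, b⟩, ⟨c, d⟩⟩ h
    simpa [Prod.ext_iff] using h

/-- The diagonal of a Hasse–Schmidt derivation in two variables supported on or above the
diagonal. -/
theorem LeibnizAt.diagonal {Q : ℕ × ℕ → Module.End k A} (hQ : ∀ n, ¬ n.1 ≤ n.2 → Q n = 0)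
    {n : ℕ} (h : LeibnizAt Q (n, n)) : LeibnizAt (fun i => Q (i, i)) n := by
  intro x y
  rw [h x y]
  symm
  refine sum_of_injOn (fun p => ((p.1, p.1), (p.2, p.2))) ?_ ?_ ?_ (fun _ _ => rfl)
  · rintro ⟨a, b⟩ _ ⟨c, d⟩ _ h
    simp only [Prod.mk.injEq] at h ⊢
    exact ⟨h.1.1, h.2.1⟩
  · rintro ⟨a, b⟩ h
    simpa using h
  · rintro ⟨⟨a, b⟩, ⟨c, d⟩⟩ hp hnot
    simp only [mem_antidiagonal, Prod.mk_add_mk, Prod.mk.injEq] at hp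
    by_cases h1 : a ≤ b
    · by_cases h2 : c ≤ d
      · refine (hnot ⟨(a, c), ?_, ?_⟩).elim
        · simpa using hp.1
        · simp only [Prod.mk.injEq, true_and]
          omega
      · simp [hQ (c, d) h2]
    · simp [hQ (a, b) h1]

end Leibniz

/-- The bracket of two `m`-integrable derivations is `m`-integrable
(for `m` a positive integer or `∞`); hence `IDer_k(A;m)` is a Lie subalgebra. -/
theorem bracket_integrable (k A : Type*) [CommRing k] [CommRing A] [Algebra k A]
    (m : ℕ∞) (hm : 1 ≤ m) (δ ε : Derivation k A A)
    (hδ : IsIntegrable m δ) (hε : IsIntegrable m ε) :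
    IsIntegrable m ⁅δ, ε⁆ := by
  obtain ⟨D, hD, hD1⟩ := hδ
  obtain ⟨E, hE, hE1⟩ := hε
  obtain ⟨Q, P, hQ0, hP0, hP, hQ, hconv⟩ := exists_factorization
    (fun n : ℕ × ℕ => n.1 ≤ n.2) (fun n => D n.1 * E n.2) (by simp [hD.1, hE.1])
  have hQ' : ∀ n : ℕ × ℕ, ¬ n.1 ≤ n.2 → Q n = 0 := fun n h =>
    hQ n (by rintro rfl; simp at h) h
  refine ⟨fun n => Q (n, n), ⟨hQ0, fun n _ hn x y => ?_⟩, ?_⟩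
  · have hL : LeibnizAt Q (n, n) := by
      refine (leibnizAt_factors (S := fun n => n.1 ≤ n.2)
        (fun i j hi hj => add_le_add hi hj) ?_ le_rfl hQ0 hP0 hP hQ hconv (n, n) ?_).1
      · rintro ⟨a, b⟩ ⟨c, d⟩ h1 h2
        simp only [Prod.ext_iff, Prod.fst_add, Prod.snd_add, Prod.fst_zero, Prod.snd_zero]
          at h1 h2 ⊢
        omega
      · rintro ⟨a, b⟩ ⟨ha, hb⟩
        exact LeibnizAt.mul_prod (hD.leibnizAt ((Nat.cast_le.mpr ha).trans hn))
          (hE.leibnizAt ((Nat.cast_le.mpr hb).trans hn))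
    rw [hL.diagonal hQ' x y, Nat.sum_antidiagonal_eq_sum_range_succ_mk]
  · have a10 : antidiagonal ((1, 0) : ℕ × ℕ) = {((1, 0), (0, 0)), ((0, 0), (1, 0))} := by
      ext ⟨⟨a, b⟩, ⟨c, d⟩⟩
      simp only [mem_antidiagonal, mem_insert, mem_singleton, Prod.mk_add_mk, Prod.mk.injEq]
      omega
    have a01 : antidiagonal ((0, 1) : ℕ × ℕ) = {((0, 1), (0, 0)), ((0, 0), (0, 1))} := by
      ext ⟨⟨a, b⟩, ⟨c, d⟩⟩
      simp only [mem_antidiagonal, mem_insert, mem_singleton, Prod.mk_add_mk, Prod.mk.injEq]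
      omega
    have a11 : antidiagonal ((1, 1) : ℕ × ℕ) =
        {((1, 1), (0, 0)), ((0, 0), (1, 1)), ((1, 0), (0, 1)), ((0, 1), (1, 0))} := by
      ext ⟨⟨a, b⟩, ⟨c, d⟩⟩
      simp only [mem_antidiagonal, mem_insert, mem_singleton, Prod.mk_add_mk, Prod.mk.injEq]
      omega
    have hQ00 : Q (0, 0) = 1 := hQ0
    have hP00 : P (0, 0) = 1 := hP0
    have hQ10 : Q (1, 0) = 0 := hQ' _ (by simp)
    have hP01 : P (0, 1) = 0 := hP _ (by simp) (by simp)
    have hP11 : P (1, 1) = 0 := hP _ (by simp) (by simp)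
    have e10 : D 1 = P (1, 0) := by simpa [a10, hQ00, hP00, hQ10, hE.1] using hconv (1, 0)
    have e01 : E 1 = Q (0, 1) := by simpa [a01, hQ00, hP00, hP01, hD.1] using hconv (0, 1)
    have e11 : D 1 * E 1 = Q (1, 1) + E 1 * D 1 := by
      simpa [a11, hQ00, hP00, hQ10, hP11, hP01, ← e10, ← e01] using hconv (1, 1)
    rw [hD1, hE1] at e11
    rw [← sub_eq_iff_eq_add] at e11
    change Q (1, 1) = _
    rw [← e11]
    ext x
    exact (Derivation.commutator_apply ..).symm
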